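/- Assume r ≥ 2 and d ≥ 3. Let t be a positive integer with 2t < 3d, and let f be a nonzero homogeneous polynomial of degree d in x_0,…,x_r over K with sr(f) = t. Suppose S(f) contains at least two non-identified decompositions. Then for every A ∈ S(f) at least one of the following holds: (a) there is a line D of ℙ^r with #(A ∩ D) ≥ ⌈(d+2)/2⌉; (b) there is a smooth conic T of ℙ^r with #(A ∩ T) ≥ d + 1; (c) d is odd and there are two distinct lines L_1 = ℙ(W_1), L_2 = ℙ(W_2) with dim_K(W_1 ∩ W_2) = 1, such that #(A ∩ L_1) = #(A ∩ L_2) = (d+1)/2 and the intersection point ℙ(W_1 ∩ W_2) is not a point of A. -/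

import Mathlib

open MvPolynomial

/-- The degree-`d` power of (a representative linear form of) a point of `ℙ^r`,
regarded as a homogeneous polynomial of degree `d` in `x_0, …, x_r`. -/
noncomputable def powForm (K : Type) [Field K] (r d : ℕ)
    (p : Projectivization K (Fin (r + 1) → K)) : MvPolynomial (Fin (r + 1)) K :=
  (∑ i, MvPolynomial.C (p.rep i) * MvPolynomial.X i) ^ d

/-- The span of the `d`-th powers of the linear forms corresponding to a set of
points of `ℙ^r`. -/
noncomputable def decompSpan (K : Type) [Field K] (r d : ℕ)
    (S : Set (Projectivization K (Fin (r + 1) → K))) :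
    Submodule K (MvPolynomial (Fin (r + 1)) K) :=
  Submodule.span K (powForm K r d '' S)

/-- The symmetric rank of `f`. -/
noncomputable def symRank (K : Type) [Field K] (r d : ℕ)
    (f : MvPolynomial (Fin (r + 1)) K) : ℕ :=
  sInf {n | ∃ A : Finset (Projectivization K (Fin (r + 1) → K)),
    A.card = n ∧ f ∈ decompSpan K r d ↑A}

/-- `S(f)`: the set of decompositions of `f`, i.e. finite sets of points of `ℙ^r`
computing the symmetric rank of `f`. -/
def decompSet (K : Type) [Field K] (r d : ℕ) (f : MvPolynomial (Fin (r + 1)) K) :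
    Set (Finset (Projectivization K (Fin (r + 1) → K))) :=
  {A | f ∈ decompSpan K r d ↑A ∧ A.card = symRank K r d f}

/-- The points of `ℙ^r` lying on the hypersurface `Z(q)`. -/
def projZeros (K : Type) [Field K] (r : ℕ) (q : MvPolynomial (Fin (r + 1)) K) :
    Set (Projectivization K (Fin (r + 1) → K)) :=
  {p | MvPolynomial.eval p.rep q = 0}

/-- A line of `ℙ^r`. -/
def IsProjLine (K : Type) [Field K] (r : ℕ)
    (L : Set (Projectivization K (Fin (r + 1) → K))) : Prop :=
  ∃ W : Submodule K (Fin (r + 1) → K), Module.finrank K W = 2 ∧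
    L = {p | p.rep ∈ W}

/-- A smooth conic of `ℙ^r`. -/
def IsSmoothConic (K : Type) [Field K] (r : ℕ)
    (C : Set (Projectivization K (Fin (r + 1) → K))) : Prop :=
  ∃ u v w : Fin (r + 1) → K, LinearIndependent K ![u, v, w] ∧
    C = {p | ∃ s t : K, (s ≠ 0 ∨ t ≠ 0) ∧
      p.submodule = Submodule.span K {s ^ 2 • u + (s * t) • v + t ^ 2 • w}}

section PointRelations

open scoped Classical LinearAlgebra.Projectivization
open Module

variable {K V : Type*} [Field K] [AddCommGroup V] [Module K V]

/-- The space of linear forms on `V`, as functions on `V`; its `d`-th power in the algebra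
`V → K` is the space of forms of degree `d`. -/
def linForms (K V : Type*) [Field K] [AddCommGroup V] [Module K V] : Submodule K (V → K) :=
  LinearMap.range (LinearMap.ltoFun K V K K)

lemma dual_mem_linForms (φ : Dual K V) : (φ : V → K) ∈ linForms K V := ⟨φ, rfl⟩

/-- The evaluations of forms of degree `d` at the points of `S` satisfy a linear relation with
all coefficients nonzero. -/
def HasFullRelation (d : ℕ) (S : Finset (ℙ K V)) : Prop :=
  ∃ c : ℙ K V → K, (∀ p ∈ S, c p ≠ 0) ∧
    ∀ F ∈ linForms K V ^ d, ∑ p ∈ S, c p * F p.rep = 0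

lemma HasFullRelation.residual {k e : ℕ} {S : Finset (ℙ K V)} (h : HasFullRelation (k + e) S)
    {F : V → K} (hF : F ∈ linForms K V ^ k) :
    HasFullRelation e (S.filter fun p => F p.rep ≠ 0) := by
  obtain ⟨c, hc, h⟩ := h
  refine ⟨fun p => c p * F p.rep, fun p hp => ?_, fun G hG => ?_⟩
  · rw [Finset.mem_filter] at hp
    exact mul_ne_zero (hc p hp.1) hp.2
  · refine Eq.trans ?_ (h (F * G) (by rw [pow_add]; exact Submodule.mul_mem_mul hF hG))
    rw [Finset.sum_filter]
    refine Finset.sum_congr rfl fun p _ => ?_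
    by_cases h0 : F p.rep = 0 <;> simp [h0, mul_assoc]

lemma exists_dual_eq_zero_on_ne_zero [Infinite K] (W : Submodule K V) (S : Finset (ℙ K V)) :
    ∃ φ : Dual K V, (∀ w ∈ W, φ w = 0) ∧ ∀ p ∈ S, p.rep ∉ W → φ p.rep ≠ 0 := by
  obtain ⟨φ, hφ⟩ := Module.exists_dual_forall_apply_ne_zero (K := K)
    (fun p : {p // p ∈ S.filter fun p => p.rep ∉ W} => W.mkQ p.1.rep)
    (fun p => by simpa using (Finset.mem_filter.1 p.2).2)
  exact ⟨φ.comp W.mkQ, fun w hw => by simp [(Submodule.Quotient.mk_eq_zero W).2 hw],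
    fun p hp hpW => hφ ⟨p, Finset.mem_filter.2 ⟨hp, hpW⟩⟩⟩

lemma HasFullRelation.diff_subspace [Infinite K] {d : ℕ} {S : Finset (ℙ K V)}
    (h : HasFullRelation (d + 1) S) (W : Submodule K V) :
    HasFullRelation d (S.filter fun p => p.rep ∉ W) := by
  obtain ⟨φ, h0, h1⟩ := exists_dual_eq_zero_on_ne_zero W S
  rw [add_comm] at h
  have := h.residual (F := φ) (by rw [pow_one]; exact dual_mem_linForms φ)
  convert this using 1
  refine Finset.filter_congr fun p hp => ⟨h1 p hp, fun h hW => h (h0 _ hW)⟩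

lemma rep_notMem_span_singleton {p q : ℙ K V} (h : p ≠ q) : p.rep ∉ K ∙ q.rep := by
  intro hm
  obtain ⟨a, ha⟩ := Submodule.mem_span_singleton.1 hm
  apply h
  rw [← p.mk_rep, ← q.mk_rep, Projectivization.mk_eq_mk_iff']
  exact ⟨a, ha⟩

lemma finrank_span_pair_rep {p q : ℙ K V} (h : p ≠ q) :
    finrank K (Submodule.span K {p.rep, q.rep}) = 2 := by
  have := finrank_span_eq_card (Projectivization.linearIndependent_pair_iff_ne.2 h)
  rwa [Fintype.card_fin, Matrix.range_cons, Matrix.range_cons, Matrix.range_empty,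
    Set.union_empty, Set.singleton_union] at this

lemma HasFullRelation.card_ge [Infinite K] {d : ℕ} {S : Finset (ℙ K V)}
    (h : HasFullRelation d S) (hS : S.Nonempty) : d + 2 ≤ S.card := by
  induction d generalizing S with
  | zero =>
    by_contra hlt
    have h1 : S.card = 1 := by have := hS.card_pos; omega
    obtain ⟨p, rfl⟩ := Finset.card_eq_one.1 h1
    obtain ⟨c, hc, h⟩ := h
    have := h 1 (by rw [pow_zero]; exact Submodule.one_le.1 le_rfl)
    exact hc p (by simp) (by simpa using this)
  | succ d ih =>
    obtain ⟨p, hp⟩ := hS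
    by_cases hq : ∃ q ∈ S, q ≠ p
    · obtain ⟨q, hq, hqp⟩ := hq
      have h1 := ih (h.diff_subspace (K ∙ p.rep))
        ⟨q, Finset.mem_filter.2 ⟨hq, rep_notMem_span_singleton hqp⟩⟩
      have h2 : (S.filter fun q => q.rep ∉ K ∙ p.rep).card < S.card :=
        Finset.card_lt_card (Finset.filter_ssubset.2
          ⟨p, hp, not_not.2 (Submodule.mem_span_singleton_self _)⟩)
      omega
    · push Not at hq
      have h1 := ih (h.diff_subspace ⊥)
        ⟨p, Finset.mem_filter.2 ⟨hp, by simpa using p.rep_nonzero⟩⟩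
      have h2 : S.card ≤ 1 := Finset.card_le_one.2 fun a ha b hb => by rw [hq a ha, hq b hb]
      have h3 := Finset.card_filter_le S fun q => q.rep ∉ (⊥ : Submodule K V)
      omega

lemma card_filter_mem_add_card_filter_notMem (S : Finset (ℙ K V)) (W : Submodule K V) :
    (S.filter fun p => p.rep ∈ W).card + (S.filter fun p => p.rep ∉ W).card = S.card :=
  Finset.card_filter_add_card_filter_not _

lemma exists_forall_le_of_bounded {α : Type*} {P : α → Prop} (f : α → ℕ) (n : ℕ)
    (hn : ∀ x, f x ≤ n) (hP : ∃ x, P x) : ∃ x, P x ∧ ∀ y, P y → f y ≤ f x := by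
  obtain ⟨x, hx, hmax⟩ := WellFounded.has_min (measure fun x => n - f x).wf {x | P x} hP
  refine ⟨x, hx, fun y hy => ?_⟩
  have h1 : ¬ (n - f y < n - f x) := hmax y hy
  have := hn x
  have := hn y
  omega

lemma exists_line_of_ne {p q : ℙ K V} (h : p ≠ q) :
    ∃ W : Submodule K V, finrank K W = 2 ∧ p.rep ∈ W ∧ q.rep ∈ W :=
  ⟨_, finrank_span_pair_rep h, Submodule.subset_span (by simp), Submodule.subset_span (by simp)⟩

/-- A line containing as many points of `S` as possible. -/
lemma exists_max_line {S : Finset (ℙ K V)} (hS : 2 ≤ S.card) :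
    ∃ W : Submodule K V, finrank K W = 2 ∧ 2 ≤ (S.filter fun p => p.rep ∈ W).card ∧
      ∀ W' : Submodule K V, finrank K W' = 2 →
        (S.filter fun p => p.rep ∈ W').card ≤ (S.filter fun p => p.rep ∈ W).card := by
  obtain ⟨p, hp, q, hq, hpq⟩ := Finset.one_lt_card.1 hS
  obtain ⟨L, hL, hpL, hqL⟩ := exists_line_of_ne hpq
  obtain ⟨W, hW, hmax⟩ := exists_forall_le_of_bounded
    (P := fun W : Submodule K V => finrank K W = 2)
    (fun W => (S.filter fun p => p.rep ∈ W).card) S.card (fun _ => Finset.card_filter_le _ _)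
    ⟨L, hL⟩
  refine ⟨W, hW, le_trans ?_ (hmax L hL), hmax⟩
  exact Finset.one_lt_card.2 ⟨p, by simp [hp, hpL], q, by simp [hq, hqL], hpq⟩

/-- No line contains three points of `S`. -/
def NoThreeCollinear (S : Finset (ℙ K V)) : Prop :=
  ∀ W : Submodule K V, finrank K W = 2 → (S.filter fun p => p.rep ∈ W).card ≤ 2

lemma NoThreeCollinear.mono {S T : Finset (ℙ K V)} (h : NoThreeCollinear S) (hT : T ⊆ S) :
    NoThreeCollinear T := fun W hW =>
  (Finset.card_le_card (Finset.filter_subset_filter _ hT)).trans (h W hW)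

lemma NoThreeCollinear.rep_notMem {S : Finset (ℙ K V)} (h : NoThreeCollinear S) {p q s : ℙ K V}
    (hp : p ∈ S) (hq : q ∈ S) (hs : s ∈ S) (hpq : p ≠ q) (hps : p ≠ s) (hqs : q ≠ s) :
    s.rep ∉ Submodule.span K {p.rep, q.rep} := by
  intro hm
  have h1 := h _ (finrank_span_pair_rep hpq)
  have h2 : ({p, q, s} : Finset (ℙ K V)) ⊆
      S.filter fun x => x.rep ∈ Submodule.span K {p.rep, q.rep} := by
    intro x hx
    simp only [Finset.mem_insert, Finset.mem_singleton] at hx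
    rcases hx with rfl | rfl | rfl
    · exact Finset.mem_filter.2 ⟨hp, Submodule.subset_span (by simp)⟩
    · exact Finset.mem_filter.2 ⟨hq, Submodule.subset_span (by simp)⟩
    · exact Finset.mem_filter.2 ⟨hs, hm⟩
  have h3 := Finset.card_le_card h2
  rw [Finset.card_eq_three.2 ⟨p, q, s, hpq, hps, hqs, rfl⟩] at h3
  omega

lemma NoThreeCollinear.linearIndependent {S : Finset (ℙ K V)} (h : NoThreeCollinear S)
    {p q s : ℙ K V} (hp : p ∈ S) (hq : q ∈ S) (hs : s ∈ S) (hpq : p ≠ q) (hps : p ≠ s)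
    (hqs : q ≠ s) : LinearIndependent K ![s.rep, p.rep, q.rep] := by
  refine linearIndependent_finCons.2
    ⟨Projectivization.linearIndependent_pair_iff_ne.2 hpq, ?_⟩
  simpa only [Matrix.range_cons, Matrix.range_empty, Set.union_empty, Set.singleton_union]
    using h.rep_notMem hp hq hs hpq hps hqs

lemma HasFullRelation.card_ge_of_noThreeCollinear [Infinite K] {d : ℕ} {S : Finset (ℙ K V)}
    (h : HasFullRelation d S) (hS : S.Nonempty) (hn : NoThreeCollinear S) :
    2 * d + 2 ≤ S.card := by
  induction d generalizing S with
  | zero => simpa using h.card_ge hS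
  | succ d ih =>
    have h2 := h.card_ge hS
    obtain ⟨W, hW, hW2, -⟩ := exists_max_line (S := S) (by omega)
    have hsum := card_filter_mem_add_card_filter_notMem S W
    have h3 := hn W hW
    have h4 := ih (h.diff_subspace W) (Finset.card_pos.1 (by omega))
      (hn.mono (Finset.filter_subset _ _))
    omega

lemma linearIndependent_triple_iff {a b c : V} : LinearIndependent K ![a, b, c] ↔
    ∀ x y z : K, x • a + y • b + z • c = 0 → x = 0 ∧ y = 0 ∧ z = 0 := by
  rw [Fintype.linearIndependent_iff]
  constructor
  · intro h x y z hxyz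
    have := h ![x, y, z] (by simpa [Fin.sum_univ_three] using hxyz)
    exact ⟨this 0, this 1, this 2⟩
  · intro h g hg
    have := h (g 0) (g 1) (g 2) (by simpa [Fin.sum_univ_three] using hg)
    intro i
    fin_cases i
    exacts [this.1, this.2.1, this.2.2]

lemma exists_dual_apply_triple {a b c : V} (h : LinearIndependent K ![a, b, c]) (x y z : K) :
    ∃ φ : Dual K V, φ a = x ∧ φ b = y ∧ φ c = z := by
  obtain ⟨φ, hφ⟩ := LinearMap.exists_extend ((Basis.span h).constr K ![x, y, z])
  have key : ∀ i, φ (![a, b, c] i) = ![x, y, z] i := fun i => by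
    rw [← Basis.constr_basis (Basis.span h) K ![x, y, z] i, ← hφ]
    simp [Basis.span_apply]
  exact ⟨φ, key 0, key 1, key 2⟩

lemma eq_span_pair_rep {W : Submodule K V} (hW : finrank K W = 2) {p q : ℙ K V} (h : p ≠ q)
    (hp : p.rep ∈ W) (hq : q.rep ∈ W) : Submodule.span K {p.rep, q.rep} = W := by
  have : FiniteDimensional K W := Module.finite_of_finrank_pos (by omega)
  refine Submodule.eq_of_le_of_finrank_eq ?_ (by rw [finrank_span_pair_rep h, hW])
  rw [Submodule.span_le]
  rintro x (rfl | rfl)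
  exacts [hp, hq]

/-- The cone over the conic parametrised by `s² u + s t v + t² w`. -/
def OnConic (u v w x : V) : Prop := ∃ s t : K, x = s ^ 2 • u + (s * t) • v + t ^ 2 • w

variable (K) in
lemma exists_quadric_separating [IsAlgClosed K] {u v w : V}
    (h : LinearIndependent K ![u, v, w]) {x : V} (hx : ¬ OnConic (K := K) u v w x) :
    ∃ q ∈ linForms K V ^ 2, (∀ y, OnConic (K := K) u v w y → q y = 0) ∧ q x ≠ 0 := by
  by_cases hs : x ∈ Submodule.span K {u, v, w}
  · obtain ⟨a, b, c, rfl⟩ := Submodule.mem_span_triple.1 hs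
    obtain ⟨X, hXu, hXv, hXw⟩ := exists_dual_apply_triple h 1 0 0
    obtain ⟨Y, hYu, hYv, hYw⟩ := exists_dual_apply_triple h 0 1 0
    obtain ⟨Z, hZu, hZv, hZw⟩ := exists_dual_apply_triple h 0 0 1
    refine ⟨(X : V → K) * Z - (Y : V → K) * Y, ?_, ?_, ?_⟩
    · rw [pow_two]
      exact Submodule.sub_mem _
        (Submodule.mul_mem_mul (dual_mem_linForms _) (dual_mem_linForms _))
        (Submodule.mul_mem_mul (dual_mem_linForms _) (dual_mem_linForms _))
    · rintro y ⟨s, t, rfl⟩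
      simp [hXu, hXv, hXw, hYu, hYv, hYw, hZu, hZv, hZw]
      ring
    · simp only [Pi.sub_apply, Pi.mul_apply, map_add, map_smul, hXu, hXv, hXw, hYu, hYv, hYw, hZu,
        hZv, hZw, smul_eq_mul]
      intro h0
      apply hx
      obtain ⟨s, hs⟩ := IsAlgClosed.exists_pow_nat_eq a (n := 2) (by norm_num)
      obtain ⟨t, ht⟩ := IsAlgClosed.exists_pow_nat_eq c (n := 2) (by norm_num)
      have h1 : (s * t - b) * (s * t + b) = 0 := by
        rw [← hs, ← ht] at h0
        linear_combination h0
      rcases mul_eq_zero.1 h1 with h1 | h1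
      · exact ⟨s, t, by rw [hs, ht, sub_eq_zero.1 h1]⟩
      · refine ⟨s, -t, ?_⟩
        rw [show s * -t = b by linear_combination -h1, hs, neg_sq, ht]
  · obtain ⟨φ, hφ0, hφ⟩ := Submodule.exists_le_ker_of_notMem hs
    refine ⟨(φ : V → K) * φ, ?_, ?_, ?_⟩
    · rw [pow_two]
      exact Submodule.mul_mem_mul (dual_mem_linForms _) (dual_mem_linForms _)
    · rintro y ⟨s, t, rfl⟩
      have hu := hφ (Submodule.subset_span (show u ∈ ({u, v, w} : Set V) by simp))
      have hv := hφ (Submodule.subset_span (show v ∈ ({u, v, w} : Set V) by simp))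
      have hw := hφ (Submodule.subset_span (show w ∈ ({u, v, w} : Set V) by simp))
      rw [LinearMap.mem_ker] at hu hv hw
      simp [hu, hv, hw]
    · exact mul_ne_zero hφ0 hφ0

lemma param_ne_of_onConic {u v w : V} {p q : ℙ K V} (hpq : p ≠ q) {s t s' t' : K}
    (hp : p.rep = s ^ 2 • u + (s * t) • v + t ^ 2 • w)
    (hq : q.rep = s' ^ 2 • u + (s' * t') • v + t' ^ 2 • w) : s * t' - s' * t ≠ 0 := by
  intro h
  have h1 : s ^ 2 • q.rep = s' ^ 2 • p.rep := by
    rw [hp, hq]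
    match_scalars
    · ring
    · linear_combination s * s' * h
    · linear_combination (s * t' + s' * t) * h
  have h2 : t ^ 2 • q.rep = t' ^ 2 • p.rep := by
    rw [hp, hq]
    match_scalars
    · linear_combination -(s * t' + s' * t) * h
    · linear_combination - t * t' * h
    · ring
  apply rep_notMem_span_singleton hpq.symm
  by_cases hs : s = 0
  · have ht : t ≠ 0 := by
      rintro rfl
      exact p.rep_nonzero (by simp [hp, hs])
    rw [← Submodule.smul_mem_iff _ (pow_ne_zero 2 ht), h2]
    exact Submodule.smul_mem _ _ (Submodule.mem_span_singleton_self _)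
  · rw [← Submodule.smul_mem_iff _ (pow_ne_zero 2 hs), h1]
    exact Submodule.smul_mem _ _ (Submodule.mem_span_singleton_self _)

lemma noThreeCollinear_of_onConic {u v w : V} (h : LinearIndependent K ![u, v, w])
    {S : Finset (ℙ K V)} (hS : ∀ p ∈ S, OnConic (K := K) u v w p.rep) : NoThreeCollinear S := by
  intro W hW
  by_contra! hlt
  obtain ⟨p, hp, q, hq, r, hr, hpq, hpr, hqr⟩ := Finset.two_lt_card.1 hlt
  rw [Finset.mem_filter] at hp hq hr
  obtain ⟨s₁, t₁, h₁⟩ := hS p hp.1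
  obtain ⟨s₂, t₂, h₂⟩ := hS q hq.1
  obtain ⟨s₃, t₃, h₃⟩ := hS r hr.1
  have hr' := hr.2
  rw [← eq_span_pair_rep hW hpq hp.2 hq.2, Submodule.mem_span_pair] at hr'
  obtain ⟨α, β, hαβ⟩ := hr'
  have hz : (α * s₁ ^ 2 + β * s₂ ^ 2 - s₃ ^ 2) • u +
      (α * (s₁ * t₁) + β * (s₂ * t₂) - s₃ * t₃) • v +
      (α * t₁ ^ 2 + β * t₂ ^ 2 - t₃ ^ 2) • w = 0 := by
    rw [h₁, h₂, h₃, ← sub_eq_zero] at hαβ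
    rw [← hαβ]
    module
  obtain ⟨e₁, e₂, e₃⟩ := linearIndependent_triple_iff.1 h _ _ _ hz
  have : (s₁ * t₃ - s₃ * t₁) * (s₂ * t₃ - s₃ * t₂) = 0 := by
    linear_combination -t₁ * t₂ * e₁ + (s₁ * t₂ + s₂ * t₁) * e₂ - s₁ * s₂ * e₃
  exact mul_ne_zero (param_ne_of_onConic hpr h₁ h₃) (param_ne_of_onConic hqr h₂ h₃) this

lemma exists_quadric_coefficients {q : V → K} (hq : q ∈ linForms K V ^ 2) (a b c : V) :
    ∃ α β γ : K, ∀ x y z : K, q (x • a + y • b + z • c) =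
      x ^ 2 * q a + y ^ 2 * q b + z ^ 2 * q c + α * (y * z) + β * (x * z) + γ * (x * y) := by
  rw [pow_two] at hq
  induction hq using Submodule.mul_induction_on' with
  | mem_mul_mem m hm n hn =>
    obtain ⟨φ, rfl⟩ := hm
    obtain ⟨ψ, rfl⟩ := hn
    refine ⟨φ b * ψ c + φ c * ψ b, φ a * ψ c + φ c * ψ a, φ a * ψ b + φ b * ψ a, fun x y z => ?_⟩
    simp only [LinearMap.ltoFun_apply, Pi.mul_apply, map_add, map_smul, smul_eq_mul]
    ring
  | add f _ g _ hf hg =>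
    obtain ⟨α, β, γ, h⟩ := hf
    obtain ⟨α', β', γ', h'⟩ := hg
    refine ⟨α + α', β + β', γ + γ', fun x y z => ?_⟩
    simp only [Pi.add_apply, h, h']
    ring

lemma minor_ne_zero_of_linearIndependent {a b c g h : V} {x y z x' y' z' : K}
    (hg : g = x • a + y • b + z • c) (hh : h = x' • a + y' • b + z' • c)
    (hli : LinearIndependent K ![c, g, h]) : x * y' - x' * y ≠ 0 := by
  intro h0
  rw [linearIndependent_triple_iff] at hli
  obtain ⟨-, hx', -⟩ := hli (x * z' - x' * z) x' (-x) (by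
    rw [hg, hh]
    match_scalars
    · ring
    · ring
    · linear_combination -h0)
  obtain ⟨-, hy', hy⟩ := hli (y * z' - y' * z) y' (-y) (by
    rw [hg, hh]
    match_scalars
    · ring
    · linear_combination h0
    · ring)
  obtain ⟨-, -, h2⟩ := hli (- z') 0 1 (by
    rw [hh, hx', hy']
    module)
  exact one_ne_zero h2

lemma eq_zero_and_eq_zero_of_minor_ne_zero {α β x y z x' y' z' : K} (hz : z ≠ 0) (hz' : z' ≠ 0)
    (h : α * (y * z) + β * (x * z) = 0) (h' : α * (y' * z') + β * (x' * z') = 0)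
    (hm : x * y' - x' * y ≠ 0) : α = 0 ∧ β = 0 := by
  have h1 : α * y + β * x = 0 := by
    apply (mul_eq_zero.1 (_ : (α * y + β * x) * z = 0)).resolve_right hz
    linear_combination h
  have h2 : α * y' + β * x' = 0 := by
    apply (mul_eq_zero.1 (_ : (α * y' + β * x') * z' = 0)).resolve_right hz'
    linear_combination h'
  constructor
  · apply (mul_eq_zero.1 (_ : α * (x * y' - x' * y) = 0)).resolve_right hm
    linear_combination x * h2 - x' * h1
  · apply (mul_eq_zero.1 (_ : β * (x * y' - x' * y) = 0)).resolve_right hm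
    linear_combination y' * h1 - y * h2

/-- A quadric through the three coordinate points whose mixed coefficients are nonzero is a
smooth conic. -/
lemma onConic_of_quadric_eq_zero [IsAlgClosed K] {a b c : V} {α β γ x y z : K}
    (hα : α ≠ 0) (hβ : β ≠ 0) (hγ : γ ≠ 0)
    (h : α * (y * z) + β * (x * z) + γ * (x * y) = 0) :
    OnConic (K := K) ((-β) • b) ((-α) • a + (-β) • b + γ • c) ((-α) • a)
      (x • a + y • b + z • c) := by
  suffices ∃ s t : K, -α * (s * t) - α * t ^ 2 = x ∧ -β * s ^ 2 - β * (s * t) = y ∧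
      γ * (s * t) = z by
    obtain ⟨s, t, rfl, rfl, rfl⟩ := this
    exact ⟨s, t, by module⟩
  by_cases hx : x = 0
  · have h1 : α * (y * z) = 0 := by simpa [hx] using h
    rcases mul_eq_zero.1 ((mul_eq_zero.1 h1).resolve_left hα) with hy | hz
    · obtain ⟨s, hs⟩ := IsAlgClosed.exists_pow_nat_eq (-z / γ) (n := 2) (by norm_num)
      refine ⟨s, -s, by rw [hx]; ring, by rw [hy]; ring, ?_⟩
      rw [show γ * (s * -s) = -(γ * s ^ 2) by ring, hs]
      field_simp
    · obtain ⟨s, hs⟩ := IsAlgClosed.exists_pow_nat_eq (-y / β) (n := 2) (by norm_num)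
      refine ⟨s, 0, by rw [hx]; ring, ?_, by rw [hz]; ring⟩
      rw [hs]
      field_simp
      ring
  by_cases hy : y = 0
  · have h1 : β * (x * z) = 0 := by simpa [hy] using h
    have hz := (mul_eq_zero.1 ((mul_eq_zero.1 h1).resolve_left hβ)).resolve_left hx
    obtain ⟨t, ht⟩ := IsAlgClosed.exists_pow_nat_eq (-x / α) (n := 2) (by norm_num)
    refine ⟨0, t, ?_, by rw [hy]; ring, by rw [hz]; ring⟩
    rw [ht]
    field_simp
    ring
  have hz : z ≠ 0 := by
    rintro rfl
    simp [hx, hy, hγ] at h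
  obtain ⟨κ, hκ⟩ := IsAlgClosed.exists_pow_nat_eq (z / (α * β * γ * x * y)) (n := 2) (by norm_num)
  have hκ' : κ ^ 2 * (α * β * γ * x * y) = z := by
    rw [hκ]
    field_simp
  refine ⟨κ * (α * y), κ * (β * x), ?_, ?_, by linear_combination hκ'⟩
  · apply mul_right_cancel₀ hz
    linear_combination -κ ^ 2 * α * β * x * h + x * hκ'
  · apply mul_right_cancel₀ hz
    linear_combination -κ ^ 2 * α * β * y * h + y * hκ'

lemma span_triple_eq {W : Submodule K V} (hW : finrank K W = 3) {a b c : V}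
    (h : LinearIndependent K ![a, b, c]) (ha : a ∈ W) (hb : b ∈ W) (hc : c ∈ W) :
    Submodule.span K {a, b, c} = W := by
  have : FiniteDimensional K W := Module.finite_of_finrank_pos (by omega)
  have h3 := finrank_span_eq_card h
  rw [Fintype.card_fin, Matrix.range_cons, Matrix.range_cons, Matrix.range_cons,
    Matrix.range_empty, Set.union_empty, Set.singleton_union, Set.singleton_union] at h3
  refine Submodule.eq_of_le_of_finrank_eq ?_ (h3.trans hW.symm)
  rw [Submodule.span_le]
  rintro x (rfl | rfl | rfl)
  exacts [ha, hb, hc]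

/-- Five or more points of a plane, no three collinear, on a common quadric that does not contain
the plane, lie on a smooth conic. -/
lemma NoThreeCollinear.exists_conic [IsAlgClosed K] {S : Finset (ℙ K V)}
    (hn : NoThreeCollinear S) (h5 : 5 ≤ S.card) {W : Submodule K V} (hW : finrank K W = 3)
    (hSW : ∀ p ∈ S, p.rep ∈ W) {q : V → K} (hq : q ∈ linForms K V ^ 2)
    (hqW : ∃ w ∈ W, q w ≠ 0) (hqS : ∀ p ∈ S, q p.rep = 0) :
    ∃ u v w : V, LinearIndependent K ![u, v, w] ∧ ∀ p ∈ S, OnConic (K := K) u v w p.rep := by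
  obtain ⟨a, ha, b, hb, c, hc, hab, hac, hbc⟩ := Finset.two_lt_card.1 (show 2 < S.card by omega)
  have h3 : ({a, b, c} : Finset (ℙ K V)).card ≤ 3 := Finset.card_le_three
  have h2 := Finset.le_card_sdiff ({a, b, c} : Finset (ℙ K V)) S
  obtain ⟨g, hg, h, hh, hgh⟩ := Finset.one_lt_card.1
    (show 1 < (S \ {a, b, c}).card by omega)
  simp only [Finset.mem_sdiff, Finset.mem_insert, Finset.mem_singleton, not_or] at hg hh
  obtain ⟨hg, hga, hgb, hgc⟩ := hg
  obtain ⟨hh, hha, hhb, hhc⟩ := hh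
  have habc : LinearIndependent K ![a.rep, b.rep, c.rep] :=
    hn.linearIndependent hb hc ha hbc hab.symm hac.symm
  have hspan := span_triple_eq hW habc (hSW a ha) (hSW b hb) (hSW c hc)
  have hcoord : ∀ x ∈ W, ∃ r s t : K, x = r • a.rep + s • b.rep + t • c.rep := fun x hx => by
    rw [← hspan] at hx
    obtain ⟨r, s, t, h⟩ := Submodule.mem_span_triple.1 hx
    exact ⟨r, s, t, h.symm⟩
  obtain ⟨α, β, γ, hform⟩ := exists_quadric_coefficients hq a.rep b.rep c.rep
  rw [hqS a ha, hqS b hb, hqS c hc] at hform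
  replace hform : ∀ x y z : K, q (x • a.rep + y • b.rep + z • c.rep) =
      α * (y * z) + β * (x * z) + γ * (x * y) := fun x y z => by rw [hform]; ring
  obtain ⟨w, hwW, hqw⟩ := hqW
  obtain ⟨wx, wy, wz, rfl⟩ := hcoord w hwW
  rw [hform] at hqw
  obtain ⟨x, y, z, hgr⟩ := hcoord _ (hSW g hg)
  obtain ⟨x', y', z', hhr⟩ := hcoord _ (hSW h hh)
  have eg : α * (y * z) + β * (x * z) + γ * (x * y) = 0 := by rw [← hform, ← hgr, hqS g hg]
  have eh : α * (y' * z') + β * (x' * z') + γ * (x' * y') = 0 := by rw [← hform, ← hhr, hqS h hh]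
  have mc := minor_ne_zero_of_linearIndependent hgr hhr
    (hn.linearIndependent hg hh hc hgh hgc hhc)
  have ma := minor_ne_zero_of_linearIndependent
    (show g.rep = y • b.rep + z • c.rep + x • a.rep by rw [hgr]; module)
    (show h.rep = y' • b.rep + z' • c.rep + x' • a.rep by rw [hhr]; module)
    (hn.linearIndependent hg hh ha hgh hga hha)
  have mb := minor_ne_zero_of_linearIndependent
    (show g.rep = z • c.rep + x • a.rep + y • b.rep by rw [hgr]; module)
    (show h.rep = z' • c.rep + x' • a.rep + y' • b.rep by rw [hhr]; module)
    (hn.linearIndependent hg hh hb hgh hgb hhb)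
  have nz : ∀ p ∈ S, p ≠ a → p ≠ b → p ≠ c → ∀ r s t : K,
      p.rep = r • a.rep + s • b.rep + t • c.rep → r ≠ 0 ∧ s ≠ 0 ∧ t ≠ 0 := by
    intro p hp hpa hpb hpc r s t hr
    refine ⟨?_, ?_, ?_⟩ <;> rintro rfl
    · exact hn.rep_notMem hb hc hp hbc hpb.symm hpc.symm
        (Submodule.mem_span_pair.2 ⟨s, t, by rw [hr]; module⟩)
    · exact hn.rep_notMem ha hc hp hac hpa.symm hpc.symm
        (Submodule.mem_span_pair.2 ⟨r, t, by rw [hr]; module⟩)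
    · exact hn.rep_notMem ha hb hp hab hpa.symm hpb.symm
        (Submodule.mem_span_pair.2 ⟨r, s, by rw [hr]; module⟩)
  obtain ⟨hx, hy, hz⟩ := nz g hg hga hgb hgc _ _ _ hgr
  obtain ⟨hx', hy', hz'⟩ := nz h hh hha hhb hhc _ _ _ hhr
  have hγ : γ ≠ 0 := by
    rintro rfl
    obtain ⟨rfl, rfl⟩ := eq_zero_and_eq_zero_of_minor_ne_zero (α := α) (β := β) hz hz'
      (by linear_combination eg) (by linear_combination eh) mc
    simp at hqw
  have hα : α ≠ 0 := by
    rintro rfl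
    obtain ⟨rfl, rfl⟩ := eq_zero_and_eq_zero_of_minor_ne_zero (α := β) (β := γ) hx hx'
      (by linear_combination eg) (by linear_combination eh) ma
    simp at hqw
  have hβ : β ≠ 0 := by
    rintro rfl
    obtain ⟨rfl, rfl⟩ := eq_zero_and_eq_zero_of_minor_ne_zero (α := γ) (β := α) hy hy'
      (by linear_combination eg) (by linear_combination eh) mb
    simp at hqw
  refine ⟨(-β) • b.rep, (-α) • a.rep + (-β) • b.rep + γ • c.rep, (-α) • a.rep, ?_, ?_⟩
  · rw [linearIndependent_triple_iff]
    intro r s t hrst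
    obtain ⟨h1, h2, h3⟩ := linearIndependent_triple_iff.1 habc (-α * (s + t)) (-β * (r + s))
      (γ * s) (by rw [← hrst]; module)
    have hs : s = 0 := by simpa [hγ] using h3
    subst hs
    exact ⟨by simpa [hβ] using h2, rfl, by simpa [hα] using h1⟩
  · intro p hp
    obtain ⟨r, s, t, hr⟩ := hcoord _ (hSW p hp)
    have hp0 := hqS p hp
    rw [hr] at hp0 ⊢
    rw [hform] at hp0
    exact onConic_of_quadric_eq_zero hα hβ hγ hp0

/-- For points no three of which are collinear, choose for each pair a linear form whose zeros
among the points are exactly that pair. -/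
lemma NoThreeCollinear.exists_line_forms [Infinite K] {S : Finset (ℙ K V)}
    (hn : NoThreeCollinear S) : ∃ L : ℙ K V → ℙ K V → Dual K V, ∀ a ∈ S, ∀ b ∈ S, a ≠ b →
      L a b a.rep = 0 ∧ L a b b.rep = 0 ∧ ∀ p ∈ S, p ≠ a → p ≠ b → L a b p.rep ≠ 0 := by
  choose L hL0 hL using fun a b : ℙ K V =>
    exists_dual_eq_zero_on_ne_zero (Submodule.span K {a.rep, b.rep}) S
  refine ⟨L, fun a ha b hb hab => ⟨hL0 a b _ (Submodule.subset_span (by simp)),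
    hL0 a b _ (Submodule.subset_span (by simp)), fun p hp hpa hpb => hL a b p hp ?_⟩⟩
  exact hn.rep_notMem ha hb hp hab hpa.symm hpb.symm

/-- No smooth conic contains six points of `S`. -/
def NoSixOnConic (S : Finset (ℙ K V)) : Prop :=
  ∀ u v w : V, LinearIndependent K ![u, v, w] →
    (S.filter fun p => OnConic (K := K) u v w p.rep).card ≤ 5

lemma NoSixOnConic.card_zeros_le [IsAlgClosed K] {S : Finset (ℙ K V)} (hn : NoThreeCollinear S)
    (h6 : NoSixOnConic S) {W : Submodule K V} (hW : finrank K W = 3) (hSW : ∀ p ∈ S, p.rep ∈ W)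
    {L : ℙ K V → ℙ K V → Dual K V} (hL : ∀ a ∈ S, ∀ b ∈ S, a ≠ b →
      L a b a.rep = 0 ∧ L a b b.rep = 0 ∧ ∀ p ∈ S, p ≠ a → p ≠ b → L a b p.rep ≠ 0)
    {a b c e : ℙ K V} (ha : a ∈ S) (hb : b ∈ S) (hc : c ∈ S) (he : e ∈ S) (hab : a ≠ b)
    (hac : a ≠ c) (hae : a ≠ e) (hbc : b ≠ c) (hbe : b ≠ e) {μ : K} (hμ : μ ≠ 0) :
    (S.filter fun p => L a b p.rep * L c e p.rep - μ * (L a c p.rep * L b e p.rep) = 0).card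
      ≤ 5 := by
  by_contra! hlt
  set T := S.filter fun p => L a b p.rep * L c e p.rep - μ * (L a c p.rep * L b e p.rep) = 0
    with hT
  have hTS : T ⊆ S := Finset.filter_subset _ _
  obtain ⟨u, v, w, huvw, hcon⟩ := (hn.mono hTS).exists_conic (by omega) hW
    (fun p hp => hSW p (hTS hp))
    (q := (L a b : V → K) * L c e - μ • ((L a c : V → K) * L b e))
    (by
      rw [pow_two]
      exact Submodule.sub_mem _
        (Submodule.mul_mem_mul (dual_mem_linForms _) (dual_mem_linForms _))
        (Submodule.smul_mem _ _
          (Submodule.mul_mem_mul (dual_mem_linForms _) (dual_mem_linForms _))))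
    ⟨a.rep + b.rep, W.add_mem (hSW a ha) (hSW b hb), by
      simp only [Pi.sub_apply, Pi.mul_apply, Pi.smul_apply, map_add, (hL a ha b hb hab).1,
        (hL a ha b hb hab).2.1, (hL a ha c hc hac).1, (hL b hb e he hbe).1, smul_eq_mul, add_zero,
        zero_add, zero_mul, zero_sub, neg_ne_zero]
      exact mul_ne_zero hμ (mul_ne_zero ((hL a ha c hc hac).2.2 b hb hab.symm hbc)
        ((hL b hb e he hbe).2.2 a ha hab hae))⟩
    (fun p hp => by simpa using (Finset.mem_filter.1 hp).2)
  have h1 : T ⊆ S.filter fun p => OnConic (K := K) u v w p.rep := fun p hp =>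
    Finset.mem_filter.2 ⟨hTS hp, hcon p hp⟩
  have h2 := Finset.card_le_card h1
  have h3 := h6 u v w huvw
  omega

/-- Every subset of `S` of cardinality `3 * k - 1` is cut out on `S` by a form of degree `k`. -/
def CutOutByForms (k : ℕ) (S : Finset (ℙ K V)) : Prop :=
  ∀ Z ⊆ S, Z.card + 1 = 3 * k → ∃ F ∈ linForms K V ^ k, ∀ p ∈ S, F p.rep = 0 ↔ p ∈ Z

lemma CutOutByForms.card_ge [Infinite K] {k e : ℕ} {S : Finset (ℙ K V)}
    (h : CutOutByForms k S) (hk : 1 ≤ k) (hS : 3 * k ≤ S.card) (hr : HasFullRelation (k + e) S)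
    (hn : NoThreeCollinear S) : 3 * k + 2 * e + 1 ≤ S.card := by
  obtain ⟨Z, hZ, hZc⟩ := Finset.exists_subset_card_eq (show 3 * k - 1 ≤ S.card by omega)
  obtain ⟨F, hF, hFZ⟩ := h Z hZ (by omega)
  have heq : (S.filter fun p => F p.rep ≠ 0) = S \ Z := by
    ext p
    simp only [Finset.mem_filter, Finset.mem_sdiff]
    exact and_congr_right fun hp => not_congr (hFZ p hp)
  have hcard := Finset.card_sdiff_add_card_eq_card hZ
  have hres := hr.residual hF
  rw [heq] at hres
  have := hres.card_ge_of_noThreeCollinear (Finset.card_pos.1 (by omega))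
    (hn.mono Finset.sdiff_subset)
  omega

lemma cutOutByForms_two [IsAlgClosed K] {S : Finset (ℙ K V)} (hn : NoThreeCollinear S)
    (h6 : NoSixOnConic S) {W : Submodule K V} (hW : finrank K W = 3)
    (hSW : ∀ p ∈ S, p.rep ∈ W) : CutOutByForms 2 S := by
  intro Z hZ hZc
  obtain ⟨L, hL⟩ := hn.exists_line_forms
  have hZ5 : Z.card = 5 := by omega
  obtain ⟨a, Z₁, haZ, rfl, hZ₁⟩ := Finset.card_eq_succ.1 hZ5
  obtain ⟨b, Z₂, hbZ, rfl, hZ₂⟩ := Finset.card_eq_succ.1 hZ₁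
  obtain ⟨c, e, g, hce, hcg, heg, rfl⟩ := Finset.card_eq_three.1 hZ₂
  simp only [Finset.mem_insert, Finset.mem_singleton, not_or] at haZ hbZ
  obtain ⟨hab, hac, hae, hag⟩ := haZ
  obtain ⟨hbc, hbe, hbg⟩ := hbZ
  simp only [Finset.insert_subset_iff, Finset.singleton_subset_iff] at hZ
  obtain ⟨ha, hb, hc, he, hg⟩ := hZ
  have n1 := (hL a ha b hb hab).2.2 g hg (Ne.symm hag) (Ne.symm hbg)
  have n2 := (hL c hc e he hce).2.2 g hg (Ne.symm hcg) (Ne.symm heg)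
  have n3 := (hL a ha c hc hac).2.2 g hg (Ne.symm hag) (Ne.symm hcg)
  have n4 := (hL b hb e he hbe).2.2 g hg (Ne.symm hbg) (Ne.symm heg)
  set μ := (L a b g.rep * L c e g.rep) / (L a c g.rep * L b e g.rep) with hμ
  have hμ0 : μ ≠ 0 := div_ne_zero (mul_ne_zero n1 n2) (mul_ne_zero n3 n4)
  have hle := h6.card_zeros_le hn hW hSW hL ha hb hc he hab hac hae hbc hbe hμ0
  refine ⟨(L a b : V → K) * L c e - μ • ((L a c : V → K) * L b e), ?_, fun p hp => ?_⟩
  · rw [pow_two]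
    exact Submodule.sub_mem _
      (Submodule.mul_mem_mul (dual_mem_linForms _) (dual_mem_linForms _))
      (Submodule.smul_mem _ _
        (Submodule.mul_mem_mul (dual_mem_linForms _) (dual_mem_linForms _)))
  · have hzero : ∀ p ∈ ({a, b, c, e, g} : Finset (ℙ K V)),
        L a b p.rep * L c e p.rep - μ * (L a c p.rep * L b e p.rep) = 0 := by
      intro p hp
      simp only [Finset.mem_insert, Finset.mem_singleton] at hp
      rcases hp with rfl | rfl | rfl | rfl | rfl
      · simp [(hL _ ha b hb hab).1, (hL _ ha c hc hac).1]
      · simp [(hL a ha _ hb hab).2.1, (hL _ hb e he hbe).1]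
      · simp [(hL a ha _ hc hac).2.1, (hL _ hc e he hce).1]
      · simp [(hL b hb _ he hbe).2.1, (hL c hc _ he hce).2.1]
      · rw [hμ]
        field_simp
        ring
    have hsub : ({a, b, c, e, g} : Finset (ℙ K V)) ⊆ S.filter fun p =>
        L a b p.rep * L c e p.rep - μ * (L a c p.rep * L b e p.rep) = 0 := by
      intro p hp
      refine Finset.mem_filter.2 ⟨?_, hzero p hp⟩
      simp only [Finset.mem_insert, Finset.mem_singleton] at hp
      rcases hp with rfl | rfl | rfl | rfl | rfl <;> assumption
    rw [Finset.eq_of_subset_of_card_le hsub (by omega), Finset.mem_filter]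
    simp [hp]

lemma CutOutByForms.succ [IsAlgClosed K] {k : ℕ} {S : Finset (ℙ K V)} (h : CutOutByForms k S)
    (hk : 1 ≤ k) (hS : 3 * k + 4 ≤ S.card) (hn : NoThreeCollinear S) (h6 : NoSixOnConic S)
    {W : Submodule K V} (hW : finrank K W = 3) (hSW : ∀ p ∈ S, p.rep ∈ W)
    (hbez : ∀ F ∈ linForms K V ^ (k + 1),
      3 * (k + 1) ≤ (S.filter fun p => F p.rep = 0).card → ∀ p ∈ S, F p.rep = 0) :
    CutOutByForms (k + 1) S := by
  intro Z hZ hZc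
  obtain ⟨L, hL⟩ := hn.exists_line_forms
  suffices ∃ F ∈ linForms K V ^ (k + 1), (∀ p ∈ Z, F p.rep = 0) ∧ ∃ p ∈ S, F p.rep ≠ 0 by
    obtain ⟨F, hF, hFZ, p, hp, hFp⟩ := this
    refine ⟨F, hF, ?_⟩
    have hsub : Z ⊆ S.filter fun p => F p.rep = 0 := fun p hp =>
      Finset.mem_filter.2 ⟨hZ hp, hFZ p hp⟩
    have hlt : (S.filter fun p => F p.rep = 0).card < 3 * (k + 1) := by
      by_contra! hge
      exact hFp (hbez F hF hge p hp)
    have heq := Finset.eq_of_subset_of_card_le hsub (by omega)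
    intro p hp
    rw [heq, Finset.mem_filter]
    simp [hp]
  by_contra! hcon
  obtain ⟨a, Z₁, haZ, rfl, hZ₁⟩ := Finset.card_eq_succ.1 (show Z.card = 3 * k + 1 + 1 by omega)
  obtain ⟨b, Z₂, hbZ, rfl, hZ₂⟩ := Finset.card_eq_succ.1 hZ₁
  obtain ⟨c, Z₃, hcZ, rfl, hZ₃⟩ :=
    Finset.card_eq_succ.1 (show Z₂.card = (3 * k - 1) + 1 by omega)
  obtain ⟨e, Y, heY, rfl, hY⟩ := Finset.card_eq_succ.1 (show Z₃.card = (3 * k - 2) + 1 by omega)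
  simp only [Finset.mem_insert, not_or] at haZ hbZ hcZ
  obtain ⟨hab, hac, hae, haY⟩ := haZ
  obtain ⟨hbc, hbe, hbY⟩ := hbZ
  obtain ⟨hce, hcY⟩ := hcZ
  simp only [Finset.insert_subset_iff] at hZ
  obtain ⟨ha, hb, hc, he, hYS⟩ := hZ
  obtain ⟨F, hF, hFZ⟩ := h (insert a Y) (Finset.insert_subset ha hYS)
    (by rw [Finset.card_insert_of_notMem haY]; omega)
  obtain ⟨G, hG, hGZ⟩ := h (insert b Y) (Finset.insert_subset hb hYS)
    (by rw [Finset.card_insert_of_notMem hbY]; omega)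
  have hbc' := hL b hb c hc hbc
  have hca' := hL c hc a ha (Ne.symm hac)
  have hbe' := hL b hb e he hbe
  have hea' := hL e he a ha (Ne.symm hae)
  have hFc : F c.rep ≠ 0 := by
    rw [Ne, hFZ c hc, Finset.mem_insert, not_or]; exact ⟨Ne.symm hac, hcY⟩
  have hFe : F e.rep ≠ 0 := by
    rw [Ne, hFZ e he, Finset.mem_insert, not_or]; exact ⟨Ne.symm hae, heY⟩
  have hGc : G c.rep ≠ 0 := by
    rw [Ne, hGZ c hc, Finset.mem_insert, not_or]; exact ⟨Ne.symm hbc, hcY⟩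
  have hGe : G e.rep ≠ 0 := by
    rw [Ne, hGZ e he, Finset.mem_insert, not_or]; exact ⟨Ne.symm hbe, heY⟩
  have hFa : F a.rep = 0 := (hFZ a ha).2 (Finset.mem_insert_self _ _)
  have hGb : G b.rep = 0 := (hGZ b hb).2 (Finset.mem_insert_self _ _)
  have n1 := hbc'.2.2 e he (Ne.symm hbe) (Ne.symm hce)
  have n2 := hca'.2.2 e he (Ne.symm hce) (Ne.symm hae)
  have n3 := hbe'.2.2 c hc (Ne.symm hbc) hce
  have n4 := hea'.2.2 c hc hce (Ne.symm hac)
  set α := -(L b c e.rep * F e.rep) / (L c a e.rep * G e.rep) with hα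
  set β := -(L b e c.rep * F c.rep) / (L e a c.rep * G c.rep) with hβ
  have hα0 : α ≠ 0 := div_ne_zero (neg_ne_zero.2 (mul_ne_zero n1 hFe)) (mul_ne_zero n2 hGe)
  have hβ0 : β ≠ 0 := div_ne_zero (neg_ne_zero.2 (mul_ne_zero n3 hFc)) (mul_ne_zero n4 hGc)
  have hmem : ∀ (φ ψ : Dual K V) (t : K),
      (φ : V → K) * F + t • ((ψ : V → K) * G) ∈ linForms K V ^ (k + 1) := fun φ ψ t => by
    rw [pow_succ']
    exact Submodule.add_mem _ (Submodule.mul_mem_mul (dual_mem_linForms _) hF)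
      (Submodule.smul_mem _ _ (Submodule.mul_mem_mul (dual_mem_linForms _) hG))
  have hYF : ∀ p ∈ Y, F p.rep = 0 := fun p hp =>
    (hFZ p (hYS hp)).2 (Finset.mem_insert_of_mem hp)
  have hYG : ∀ p ∈ Y, G p.rep = 0 := fun p hp =>
    (hGZ p (hYS hp)).2 (Finset.mem_insert_of_mem hp)
  have h1 := hcon _ (hmem (L b c) (L c a) α) (by
    intro p hp
    simp only [Finset.mem_insert] at hp
    simp only [Pi.add_apply, Pi.mul_apply, Pi.smul_apply, smul_eq_mul]
    rcases hp with rfl | rfl | rfl | rfl | hp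
    · simp [hFa, hca'.2.1]
    · simp [hGb, hbc'.1]
    · simp [hca'.1, hbc'.2.1]
    · rw [hα]
      field_simp
      ring
    · simp [hYF p hp, hYG p hp])
  have h2 := hcon _ (hmem (L b e) (L e a) β) (by
    intro p hp
    simp only [Finset.mem_insert] at hp
    simp only [Pi.add_apply, Pi.mul_apply, Pi.smul_apply, smul_eq_mul]
    rcases hp with rfl | rfl | rfl | rfl | hp
    · simp [hFa, hea'.2.1]
    · simp [hGb, hbe'.1]
    · rw [hβ]
      field_simp
      ring
    · simp [hea'.1, hbe'.2.1]
    · simp [hYF p hp, hYG p hp])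
  simp only [Pi.add_apply, Pi.mul_apply, Pi.smul_apply, smul_eq_mul] at h1 h2
  have hle := h6.card_zeros_le hn hW hSW hL hb hc he ha hbc hbe (Ne.symm hab) hce
    (Ne.symm hac) (div_ne_zero hα0 hβ0)
  have hsub : S \ Y ⊆ S.filter fun p =>
      L b c p.rep * L e a p.rep - α / β * (L b e p.rep * L c a p.rep) = 0 := by
    intro p hp
    obtain ⟨hp, hpY⟩ := Finset.mem_sdiff.1 hp
    refine Finset.mem_filter.2 ⟨hp, ?_⟩
    by_cases hpa : p = a
    · subst hpa
      simp [hca'.2.1, hea'.2.1]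
    · have hFp : F p.rep ≠ 0 := by
        rw [Ne, hFZ p hp, Finset.mem_insert, not_or]
        exact ⟨hpa, hpY⟩
      apply (mul_eq_zero.1 (_ : (β * F p.rep) * _ = 0)).resolve_left (mul_ne_zero hβ0 hFp)
      field_simp
      linear_combination β * L e a p.rep * h1 p hp - α * L c a p.rep * h2 p hp
  have hcard := Finset.card_le_card hsub
  have := Finset.card_sdiff_add_card_eq_card hYS
  omega

lemma HasFullRelation.not_noSixOnConic [IsAlgClosed K] {d : ℕ} {S : Finset (ℙ K V)}
    (h : HasFullRelation d S) (hS : S.Nonempty) (hcard : S.card + 1 ≤ 3 * d)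
    (hn : NoThreeCollinear S) {W : Submodule K V} (hW : finrank K W = 3)
    (hSW : ∀ p ∈ S, p.rep ∈ W)
    (hbez : ∀ k, 1 ≤ k → k < d → ∀ F ∈ linForms K V ^ k,
      3 * k ≤ (S.filter fun p => F p.rep = 0).card → ∀ p ∈ S, F p.rep = 0) :
    ¬ NoSixOnConic S := by
  intro h6
  have h2d := h.card_ge_of_noThreeCollinear hS hn
  have key : ∀ k, 2 ≤ k → k < d → CutOutByForms k S ∧ 3 * k ≤ S.card := by
    intro k hk
    induction k, hk using Nat.le_induction with
    | base => exact fun _ => ⟨cutOutByForms_two hn h6 hW hSW, by omega⟩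
    | succ k hk ih =>
      intro hkd
      obtain ⟨hcut, hle⟩ := ih (by omega)
      obtain ⟨e, rfl⟩ := Nat.exists_eq_add_of_le (show k ≤ d by omega)
      have := hcut.card_ge (by omega) hle h hn
      exact ⟨hcut.succ (by omega) (by omega) hn h6 hW hSW (hbez (k + 1) (by omega) hkd), by omega⟩
  obtain ⟨hcut, hle⟩ := key (d - 1) (by omega) (by omega)
  rw [show d = (d - 1) + 1 by omega] at h
  have := hcut.card_ge (by omega) hle h hn
  omega

/-- The points of `S` lie on the union of two lines. -/
def OnTwoLines (S : Finset (ℙ K V)) : Prop :=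
  ∃ W₁ W₂ : Submodule K V, finrank K W₁ = 2 ∧ finrank K W₂ = 2 ∧
    ∀ p ∈ S, p.rep ∈ W₁ ∨ p.rep ∈ W₂

/-- The points of `S` lie on a smooth conic. -/
def OnSmoothConic (S : Finset (ℙ K V)) : Prop :=
  ∃ u v w : V, LinearIndependent K ![u, v, w] ∧ ∀ p ∈ S, OnConic (K := K) u v w p.rep

lemma OnSmoothConic.noThreeCollinear {S : Finset (ℙ K V)} (h : OnSmoothConic S) :
    NoThreeCollinear S := by
  obtain ⟨u, v, w, hL, hS⟩ := h
  exact noThreeCollinear_of_onConic hL hS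

lemma NoThreeCollinear.card_le_of_onTwoLines {S : Finset (ℙ K V)} (hn : NoThreeCollinear S)
    (h : OnTwoLines S) : S.card ≤ 4 := by
  obtain ⟨W₁, W₂, h₁, h₂, hS⟩ := h
  have h3 := hn W₁ h₁
  have h4 := hn W₂ h₂
  have h5 : S ⊆ (S.filter fun p => p.rep ∈ W₁) ∪ S.filter fun p => p.rep ∈ W₂ := by
    intro p hp
    simp only [Finset.mem_union, Finset.mem_filter]
    exact (hS p hp).imp (⟨hp, ·⟩) (⟨hp, ·⟩)
  have h6 := (Finset.card_le_card h5).trans (Finset.card_union_le _ _)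
  omega

lemma card_filter_eq_zero_add_card_filter_ne_zero (S : Finset (ℙ K V)) (F : V → K) :
    (S.filter fun p => F p.rep = 0).card + (S.filter fun p => F p.rep ≠ 0).card = S.card :=
  Finset.card_filter_add_card_filter_not _

lemma HasFullRelation.onSmoothConic_residual [Infinite K] {k e : ℕ} {S : Finset (ℙ K V)}
    (h : HasFullRelation (k + e) S) (hcard : S.card + 1 ≤ 3 * (k + e)) (hn : NoThreeCollinear S)
    (ih : ∀ T : Finset (ℙ K V), HasFullRelation e T → T.Nonempty → T.card + 1 ≤ 3 * e →
      OnTwoLines T ∨ OnSmoothConic T)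
    {F : V → K} (hF : F ∈ linForms K V ^ k)
    (hz : 3 * k ≤ (S.filter fun p => F p.rep = 0).card)
    (hne : (S.filter fun p => F p.rep ≠ 0).Nonempty) :
    OnSmoothConic (S.filter fun p => F p.rep ≠ 0) ∧
      2 * e + 2 ≤ (S.filter fun p => F p.rep ≠ 0).card := by
  have hr := h.residual hF
  have hn' := hn.mono (Finset.filter_subset (fun p => F p.rep ≠ 0) S)
  have h1 := hr.card_ge_of_noThreeCollinear hne hn'
  have h2 := card_filter_eq_zero_add_card_filter_ne_zero S F
  refine ⟨(ih _ hr hne (by omega)).resolve_left fun h3 => ?_, h1⟩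
  have h4 := hn'.card_le_of_onTwoLines h3
  omega

/-- A plane containing as many points of `S` as possible. -/
lemma exists_max_plane {S : Finset (ℙ K V)} (hn : NoThreeCollinear S) (hS : 3 ≤ S.card) :
    ∃ W : Submodule K V, finrank K W = 3 ∧ 3 ≤ (S.filter fun p => p.rep ∈ W).card ∧
      ∀ W' : Submodule K V, finrank K W' = 3 →
        (S.filter fun p => p.rep ∈ W').card ≤ (S.filter fun p => p.rep ∈ W).card := by
  obtain ⟨p, hp, q, hq, s, hs, hpq, hps, hqs⟩ := Finset.two_lt_card.1 hS
  have hL : finrank K (Submodule.span K (Set.range ![s.rep, p.rep, q.rep])) = 3 := by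
    simpa using finrank_span_eq_card (hn.linearIndependent hp hq hs hpq hps hqs)
  obtain ⟨W, hW, hmax⟩ := exists_forall_le_of_bounded
    (P := fun W : Submodule K V => finrank K W = 3)
    (fun W => (S.filter fun p => p.rep ∈ W).card) S.card (fun _ => Finset.card_filter_le _ _)
    ⟨_, hL⟩
  refine ⟨W, hW, le_trans ?_ (hmax _ hL), hmax⟩
  refine Finset.two_lt_card.2 ⟨p, ?_, q, ?_, s, ?_, hpq, hps, hqs⟩ <;>
    refine Finset.mem_filter.2 ⟨by assumption, Submodule.subset_span ?_⟩ <;> simp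

lemma mem_span_of_onConic {u v w x : V} (h : OnConic (K := K) u v w x) :
    x ∈ Submodule.span K (Set.range ![u, v, w]) := by
  obtain ⟨s, t, rfl⟩ := h
  refine add_mem (add_mem ?_ ?_) ?_ <;>
    refine Submodule.smul_mem _ _ (Submodule.subset_span ?_) <;> simp

lemma HasFullRelation.mem_of_max_plane [Infinite K] {e : ℕ} {S : Finset (ℙ K V)}
    (h : HasFullRelation (1 + e) S) (hcard : S.card + 1 ≤ 3 * (1 + e)) (hn : NoThreeCollinear S)
    (ih : ∀ T : Finset (ℙ K V), HasFullRelation e T → T.Nonempty → T.card + 1 ≤ 3 * e →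
      OnTwoLines T ∨ OnSmoothConic T) {W : Submodule K V}
    (h3 : 3 ≤ (S.filter fun p => p.rep ∈ W).card)
    (hmax : ∀ W' : Submodule K V, finrank K W' = 3 →
        (S.filter fun p => p.rep ∈ W').card ≤ (S.filter fun p => p.rep ∈ W).card) :
    ∀ p ∈ S, p.rep ∈ W := by
  by_contra! hp
  obtain ⟨p, hp, hpW⟩ := hp
  obtain ⟨φ, h0, h1⟩ := exists_dual_eq_zero_on_ne_zero W S
  have hz : (S.filter fun p => p.rep ∈ W).card ≤ (S.filter fun p => φ p.rep = 0).card :=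
    Finset.card_le_card (Finset.monotone_filter_right S fun p hp => h0 _)
  obtain ⟨⟨u, v, w, hL, hT⟩, h2⟩ := h.onSmoothConic_residual hcard hn ih (F := φ)
    (by rw [pow_one]; exact dual_mem_linForms φ) (by omega)
    ⟨p, Finset.mem_filter.2 ⟨hp, h1 p hp hpW⟩⟩
  have h4 := hmax (Submodule.span K (Set.range ![u, v, w])) (by simpa using finrank_span_eq_card hL)
  have h5 : (S.filter fun p => φ p.rep ≠ 0) ⊆
      S.filter fun p => p.rep ∈ Submodule.span K (Set.range ![u, v, w]) := fun p hp =>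
    Finset.mem_filter.2 ⟨(Finset.mem_filter.1 hp).1, mem_span_of_onConic (hT p hp)⟩
  have h6 := Finset.card_le_card h5
  have h7 := card_filter_eq_zero_add_card_filter_ne_zero S φ
  omega

lemma HasFullRelation.onSmoothConic_of_max_conic [IsAlgClosed K] {e : ℕ} {S : Finset (ℙ K V)}
    (h : HasFullRelation (2 + e) S) (hcard : S.card + 1 ≤ 3 * (2 + e)) (hn : NoThreeCollinear S)
    (ih : ∀ T : Finset (ℙ K V), HasFullRelation e T → T.Nonempty → T.card + 1 ≤ 3 * e →
      OnTwoLines T ∨ OnSmoothConic T) (h6 : ¬ NoSixOnConic S) : OnSmoothConic S := by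
  simp only [NoSixOnConic, not_forall, not_le] at h6
  obtain ⟨u₀, v₀, w₀, hL₀, h6⟩ := h6
  obtain ⟨⟨u, v, w⟩, hL, hmax⟩ := exists_forall_le_of_bounded
    (P := fun T : V × V × V => LinearIndependent K ![T.1, T.2.1, T.2.2])
    (fun T => (S.filter fun p => OnConic (K := K) T.1 T.2.1 T.2.2 p.rep).card) S.card
    (fun _ => Finset.card_filter_le _ _) ⟨(u₀, v₀, w₀), hL₀⟩
  simp only at hL hmax
  refine ⟨u, v, w, hL, ?_⟩
  by_contra! hp
  obtain ⟨p, hp, hpT⟩ := hp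
  obtain ⟨q, hq, hqT, hqp⟩ := exists_quadric_separating K hL hpT
  have hz : (S.filter fun p => OnConic (K := K) u v w p.rep).card ≤
      (S.filter fun p => q p.rep = 0).card :=
    Finset.card_le_card (Finset.monotone_filter_right S fun p hp => hqT _)
  have h7 := hmax (u₀, v₀, w₀) hL₀
  simp only at h7
  obtain ⟨⟨u', v', w', hL', hT'⟩, h2⟩ := h.onSmoothConic_residual hcard hn ih hq (by omega)
    ⟨p, Finset.mem_filter.2 ⟨hp, hqp⟩⟩
  have h4 := hmax (u', v', w') hL'
  simp only at h4
  have h5 : (S.filter fun p => q p.rep ≠ 0) ⊆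
      S.filter fun p => OnConic (K := K) u' v' w' p.rep := fun p hp =>
    Finset.mem_filter.2 ⟨(Finset.mem_filter.1 hp).1, hT' p hp⟩
  have h8 := Finset.card_le_card h5
  have h9 := card_filter_eq_zero_add_card_filter_ne_zero S q
  omega

lemma HasFullRelation.onSmoothConic_of_noThreeCollinear [IsAlgClosed K] {d : ℕ}
    {S : Finset (ℙ K V)} (h : HasFullRelation d S) (hS : S.Nonempty)
    (hcard : S.card + 1 ≤ 3 * d) (hn : NoThreeCollinear S)
    (ih : ∀ e < d, ∀ T : Finset (ℙ K V), HasFullRelation e T → T.Nonempty → T.card + 1 ≤ 3 * e →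
      OnTwoLines T ∨ OnSmoothConic T) : OnSmoothConic S := by
  have h1 := h.card_ge_of_noThreeCollinear hS hn
  obtain ⟨W, hW, hW3, hmax⟩ := exists_max_plane hn (by omega)
  have hSW : ∀ p ∈ S, p.rep ∈ W := by
    obtain ⟨e, rfl⟩ : ∃ e, d = 1 + e := ⟨d - 1, by omega⟩
    exact h.mem_of_max_plane hcard hn (ih e (by omega)) hW3 hmax
  by_cases h6 : NoSixOnConic S
  · refine absurd h6 (h.not_noSixOnConic hS hcard hn hW hSW ?_)
    intro k hk hkd F hF hz
    by_contra! hp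
    obtain ⟨p, hp, hpF⟩ := hp
    obtain ⟨e, rfl⟩ : ∃ e, d = k + e := ⟨d - k, by omega⟩
    have hr := h.onSmoothConic_residual hcard hn (ih e (by omega)) hF hz
      ⟨p, Finset.mem_filter.2 ⟨hp, hpF⟩⟩
    obtain ⟨⟨u, v, w, hL, hT⟩, h2⟩ := hr
    have h3 := h6 u v w hL
    have h4 : (S.filter fun p => F p.rep ≠ 0) ⊆
        S.filter fun p => OnConic (K := K) u v w p.rep := fun p hp =>
      Finset.mem_filter.2 ⟨(Finset.mem_filter.1 hp).1, hT p hp⟩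
    have h5 := Finset.card_le_card h4
    have h7 := card_filter_eq_zero_add_card_filter_ne_zero S F
    omega
  · obtain ⟨e, rfl⟩ : ∃ e, d = 2 + e := ⟨d - 2, by omega⟩
    exact h.onSmoothConic_of_max_conic hcard hn (ih e (by omega)) h6

lemma HasFullRelation.onTwoLines_of_residual [Infinite K] {e : ℕ} {S : Finset (ℙ K V)}
    (h : HasFullRelation (e + 1) S) (hcard : S.card + 1 ≤ 3 * (e + 1)) {W : Submodule K V}
    (hW2 : 2 ≤ (S.filter fun p => p.rep ∈ W).card) (hW : finrank K W = 2)
    (hmax : ∀ W' : Submodule K V, finrank K W' = 2 →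
        (S.filter fun p => p.rep ∈ W').card ≤ (S.filter fun p => p.rep ∈ W).card)
    (h2 : OnTwoLines (S.filter fun p => p.rep ∉ W)) : OnTwoLines S := by
  obtain ⟨W₁, W₂, h₁, h₂, hS⟩ := h2
  have hr := h.diff_subspace W
  set T := S.filter fun p => p.rep ∉ W with hT
  have key : ∀ U : Submodule K V, finrank K U = 2 → (∀ p ∈ T, p.rep ∈ U) → OnTwoLines S := by
    refine fun U hU hTU => ⟨W, U, hW, hU, fun p hp => ?_⟩
    by_cases hpW : p.rep ∈ W
    · exact Or.inl hpW
    · exact Or.inr (hTU p (Finset.mem_filter.2 ⟨hp, hpW⟩))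
  by_cases hT1 : ∀ p ∈ T, p.rep ∈ W₁
  · exact key W₁ h₁ hT1
  by_cases hT2 : ∀ p ∈ T, p.rep ∈ W₂
  · exact key W₂ h₂ hT2
  exfalso
  push Not at hT1 hT2
  obtain ⟨p, hp, hpW⟩ := hT1
  obtain ⟨q, hq, hqW⟩ := hT2
  have hge := hr.card_ge ⟨p, hp⟩
  have hsum := card_filter_mem_add_card_filter_notMem S W
  obtain rfl | ⟨k, rfl⟩ : e = 0 ∨ ∃ k, e = k + 1 := by
    cases e with
    | zero => exact Or.inl rfl
    | succ k => exact Or.inr ⟨k, rfl⟩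
  · rw [← hT] at hsum
    omega
  have h3 := (hr.diff_subspace W₁).card_ge ⟨p, Finset.mem_filter.2 ⟨hp, hpW⟩⟩
  have h4 := (hr.diff_subspace W₂).card_ge ⟨q, Finset.mem_filter.2 ⟨hq, hqW⟩⟩
  have h5 : (T.filter fun p => p.rep ∉ W₁) ⊆ S.filter fun p => p.rep ∈ W₂ := by
    intro x hx
    rw [Finset.mem_filter] at hx
    exact Finset.mem_filter.2 ⟨(Finset.mem_filter.1 hx.1).1, (hS x hx.1).resolve_left hx.2⟩
  have h6 : Disjoint (T.filter fun p => p.rep ∉ W₁) (T.filter fun p => p.rep ∉ W₂) := by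
    rw [Finset.disjoint_filter]
    intro x hx hx1
    exact not_not.2 ((hS x hx).resolve_left hx1)
  have h7 := Finset.card_le_card (Finset.union_subset (Finset.filter_subset (fun p => p.rep ∉ W₁) T)
    (Finset.filter_subset (fun p => p.rep ∉ W₂) T))
  rw [Finset.card_union_of_disjoint h6] at h7
  have h8 := Finset.card_le_card h5
  have h9 := hmax W₂ h₂
  rw [← hT] at hsum
  omega

lemma HasFullRelation.onSmoothConic_of_diff_line [IsAlgClosed K] {e : ℕ} {S : Finset (ℙ K V)}
    (h : HasFullRelation (e + 1) S) (hcard : S.card + 1 ≤ 3 * (e + 1)) {W : Submodule K V}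
    (hne : (S.filter fun p => p.rep ∉ W).Nonempty)
    (h2 : OnSmoothConic (S.filter fun p => p.rep ∉ W)) : OnSmoothConic S := by
  have h1 := (h.diff_subspace W).card_ge_of_noThreeCollinear hne h2.noThreeCollinear
  have hsum := card_filter_mem_add_card_filter_notMem S W
  obtain ⟨u, v, w, hL, hT⟩ := h2
  refine ⟨u, v, w, hL, fun p hp => ?_⟩
  by_contra hpT
  obtain ⟨q, hq, hqT, hqp⟩ := exists_quadric_separating K hL hpT
  have hsub : (S.filter fun p => q p.rep ≠ 0) ⊆ S.filter fun p => p.rep ∈ W := by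
    intro x hx
    rw [Finset.mem_filter] at hx ⊢
    refine ⟨hx.1, ?_⟩
    by_contra hxW
    exact hx.2 (hqT _ (hT x (Finset.mem_filter.2 ⟨hx.1, hxW⟩)))
  have h3 := Finset.card_le_card hsub
  obtain rfl | ⟨k, rfl⟩ : e = 0 ∨ ∃ k, e = k + 1 := by
    cases e with
    | zero => exact Or.inl rfl
    | succ k => exact Or.inr ⟨k, rfl⟩
  · have := h.card_ge ⟨p, hp⟩
    omega
  rw [show k + 1 + 1 = 2 + k by omega] at h
  have h4 := (h.residual hq).card_ge ⟨p, Finset.mem_filter.2 ⟨hp, hqp⟩⟩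
  omega

/-- A set of at most `3 * d - 1` points, minimally dependent on forms of degree `d`, lies on two
lines or on a smooth conic. -/
theorem HasFullRelation.onTwoLines_or_onSmoothConic [IsAlgClosed K] {d : ℕ} {S : Finset (ℙ K V)}
    (h : HasFullRelation d S) (hS : S.Nonempty) (hcard : S.card + 1 ≤ 3 * d) :
    OnTwoLines S ∨ OnSmoothConic S := by
  induction d using Nat.strong_induction_on generalizing S with
  | _ d ih =>
    have hge := h.card_ge hS
    obtain ⟨W, hW, hW2, hmax⟩ := exists_max_line (S := S) (by omega)
    by_cases hm : (S.filter fun p => p.rep ∈ W).card ≤ 2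
    · exact Or.inr (h.onSmoothConic_of_noThreeCollinear hS hcard
        (fun W' hW' => (hmax W' hW').trans hm) fun e he T hT hTne => ih e he hT hTne)
    obtain ⟨e, rfl⟩ : ∃ e, d = e + 1 := ⟨d - 1, by omega⟩
    by_cases hne : (S.filter fun p => p.rep ∉ W).Nonempty
    · have hsum := card_filter_mem_add_card_filter_notMem S W
      exact (ih e (by omega) (h.diff_subspace W) hne (by omega)).imp
        (h.onTwoLines_of_residual hcard hW2 hW hmax) (h.onSmoothConic_of_diff_line hcard hne)
    · refine Or.inl ⟨W, W, hW, hW, fun p hp => Or.inl ?_⟩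
      by_contra hpW
      exact hne ⟨p, Finset.mem_filter.2 ⟨hp, hpW⟩⟩

lemma HasFullRelation.card_diff_ge [Infinite K] {e : ℕ} {S : Finset (ℙ K V)}
    (h : HasFullRelation (e + 1) S) {W₁ W₂ : Submodule K V}
    (hS : ∀ p ∈ S, p.rep ∈ W₁ ∨ p.rep ∈ W₂) (hW : W₁ ⊓ W₂ = ⊥)
    (hne : (S.filter fun p => p.rep ∉ W₁).Nonempty) :
    e + 3 ≤ (S.filter fun p => p.rep ∉ W₁).card := by
  have h1 := (h.diff_subspace W₁).card_ge hne
  obtain ⟨p, hp, q, hq, hpq⟩ := Finset.one_lt_card.1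
    (show 1 < (S.filter fun p => p.rep ∉ W₁).card by omega)
  rw [Finset.mem_filter] at hp hq
  have hpW := (hS p hp.1).resolve_left hp.2
  have hqW := (hS q hq.1).resolve_left hq.2
  have hqU : q.rep ∉ W₁ ⊔ K ∙ p.rep := by
    intro hm
    obtain ⟨w, hw, z, hz, hwz⟩ := Submodule.mem_sup.1 hm
    obtain ⟨a, rfl⟩ := Submodule.mem_span_singleton.1 hz
    have h0 : w ∈ W₁ ⊓ W₂ := by
      refine ⟨hw, ?_⟩
      rw [eq_sub_of_add_eq hwz]
      exact sub_mem hqW (Submodule.smul_mem _ _ hpW)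
    rw [hW, Submodule.mem_bot] at h0
    refine rep_notMem_span_singleton hpq.symm ?_
    rwa [← hwz, h0, zero_add]
  have h2 := (h.diff_subspace (W₁ ⊔ K ∙ p.rep)).card_ge ⟨q, Finset.mem_filter.2 ⟨hq.1, hqU⟩⟩
  have h3 : (S.filter fun x => x.rep ∉ W₁ ⊔ K ∙ p.rep) ⊂ S.filter fun x => x.rep ∉ W₁ := by
    refine Finset.ssubset_iff_of_subset (fun x hx => ?_) |>.2
      ⟨p, Finset.mem_filter.2 hp, fun hx => ?_⟩
    · rw [Finset.mem_filter] at hx ⊢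
      exact ⟨hx.1, fun hxW => hx.2 (Submodule.mem_sup_left hxW)⟩
    · exact (Finset.mem_filter.1 hx).2
        (Submodule.mem_sup_right (Submodule.mem_span_singleton_self _))
  have h4 := Finset.card_lt_card h3
  omega

lemma finrank_inf_eq_zero_or_one {W₁ W₂ : Submodule K V} (h₁ : finrank K W₁ = 2)
    (h₂ : finrank K W₂ = 2) (h : W₁ ≠ W₂) : W₁ ⊓ W₂ = ⊥ ∨ finrank K ↥(W₁ ⊓ W₂) = 1 := by
  have : FiniteDimensional K W₁ := FiniteDimensional.of_finrank_pos (by omega)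
  have : FiniteDimensional K W₂ := FiniteDimensional.of_finrank_pos (by omega)
  have h3 := Submodule.finrank_mono (inf_le_left : W₁ ⊓ W₂ ≤ W₁)
  have h4 : finrank K ↥(W₁ ⊓ W₂) ≠ 2 := by
    intro h5
    have h6 := Submodule.eq_of_le_of_finrank_eq (inf_le_left : W₁ ⊓ W₂ ≤ W₁) (h5.trans h₁.symm)
    have h7 := Submodule.eq_of_le_of_finrank_eq (inf_le_right : W₁ ⊓ W₂ ≤ W₂) (h5.trans h₂.symm)
    exact h (h6.symm.trans h7)
  by_cases h0 : finrank K ↥(W₁ ⊓ W₂) = 0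
  · exact Or.inl (Submodule.finrank_eq_zero.1 h0)
  · right; omega

lemma HasFullRelation.exists_conic_of_onSmoothConic [IsAlgClosed K] {d : ℕ} {S A : Finset (ℙ K V)}
    (h : HasFullRelation d S) (hS : S.Nonempty) (hA : S.card ≤ 2 * (S ∩ A).card)
    (hC : OnSmoothConic S) : ∃ u v w : V, LinearIndependent K ![u, v, w] ∧
      d + 1 ≤ (A.filter fun p => OnConic (K := K) u v w p.rep).card := by
  have h1 := h.card_ge_of_noThreeCollinear hS hC.noThreeCollinear
  obtain ⟨u, v, w, hL, hT⟩ := hC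
  refine ⟨u, v, w, hL, ?_⟩
  have h2 : S ∩ A ⊆ A.filter fun p => OnConic (K := K) u v w p.rep := by
    intro p hp
    rw [Finset.mem_inter] at hp
    exact Finset.mem_filter.2 ⟨hp.2, hT p hp.1⟩
  have h3 := Finset.card_le_card h2
  omega

lemma HasFullRelation.exists_line_of_subset_line [Infinite K] {d : ℕ} {S A : Finset (ℙ K V)}
    (h : HasFullRelation d S) (hS : S.Nonempty) (hA : S.card ≤ 2 * (S ∩ A).card)
    {W : Submodule K V} (hW : ∀ p ∈ S, p.rep ∈ W) :
    (d + 3) / 2 ≤ (A.filter fun p => p.rep ∈ W).card := by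
  have h1 := h.card_ge hS
  have h2 : S ∩ A ⊆ A.filter fun p => p.rep ∈ W := by
    intro p hp
    rw [Finset.mem_inter] at hp
    exact Finset.mem_filter.2 ⟨hp.2, hW p hp.1⟩
  have h3 := Finset.card_le_card h2
  omega

lemma card_diff_add_card_diff_le {S : Finset (ℙ K V)} {W₁ W₂ : Submodule K V}
    (hS : ∀ p ∈ S, p.rep ∈ W₁ ∨ p.rep ∈ W₂) :
    (S.filter fun p => p.rep ∉ W₁).card + (S.filter fun p => p.rep ∉ W₂).card ≤ S.card := by
  have h1 : Disjoint (S.filter fun p => p.rep ∉ W₁) (S.filter fun p => p.rep ∉ W₂) := by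
    rw [Finset.disjoint_filter]
    intro x hx hx1
    exact not_not.2 ((hS x hx).resolve_left hx1)
  rw [← Finset.card_union_of_disjoint h1]
  exact Finset.card_le_card (Finset.union_subset (Finset.filter_subset _ S)
    (Finset.filter_subset _ S))

lemma HasFullRelation.trichotomy_of_onTwoLines [Infinite K] {e : ℕ} {S A : Finset (ℙ K V)}
    (h : HasFullRelation (e + 1) S) (hS : S.Nonempty) (hA : S.card ≤ 2 * (S ∩ A).card)
    (hT : OnTwoLines S) :
    (∃ W : Submodule K V, finrank K W = 2 ∧
      (e + 1 + 3) / 2 ≤ (A.filter fun p => p.rep ∈ W).card) ∨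
    (Odd (e + 1) ∧ ∃ W₁ W₂ : Submodule K V, finrank K W₁ = 2 ∧ finrank K W₂ = 2 ∧ W₁ ≠ W₂ ∧
      finrank K ↥(W₁ ⊓ W₂) = 1 ∧ (A.filter fun p => p.rep ∈ W₁).card = (e + 1 + 1) / 2 ∧
      (A.filter fun p => p.rep ∈ W₂).card = (e + 1 + 1) / 2 ∧ ∀ p ∈ A, p.rep ∉ W₁ ⊓ W₂) := by
  obtain ⟨W₁, W₂, h₁, h₂, hU⟩ := hT
  by_cases hS1 : ∀ p ∈ S, p.rep ∈ W₁
  · exact Or.inl ⟨W₁, h₁, h.exists_line_of_subset_line hS hA hS1⟩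
  by_cases hS2 : ∀ p ∈ S, p.rep ∈ W₂
  · exact Or.inl ⟨W₂, h₂, h.exists_line_of_subset_line hS hA hS2⟩
  have hne : W₁ ≠ W₂ := fun h12 => hS2 fun p hp => by simpa [h12] using hU p hp
  push Not at hS1 hS2
  obtain ⟨p, hp, hpW⟩ := hS1
  obtain ⟨q, hq, hqW⟩ := hS2
  have hp' : (S.filter fun p => p.rep ∉ W₁).Nonempty := ⟨p, Finset.mem_filter.2 ⟨hp, hpW⟩⟩
  have hq' : (S.filter fun p => p.rep ∉ W₂).Nonempty := ⟨q, Finset.mem_filter.2 ⟨hq, hqW⟩⟩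
  have h3 := (h.diff_subspace W₁).card_ge hp'
  have h4 := (h.diff_subspace W₂).card_ge hq'
  have h5 := card_diff_add_card_diff_le hU
  by_cases hA1 : (e + 1 + 3) / 2 ≤ (A.filter fun p => p.rep ∈ W₁).card
  · exact Or.inl ⟨W₁, h₁, hA1⟩
  by_cases hA2 : (e + 1 + 3) / 2 ≤ (A.filter fun p => p.rep ∈ W₂).card
  · exact Or.inl ⟨W₂, h₂, hA2⟩
  have h6 : S ∩ A ⊆ (A.filter fun p => p.rep ∈ W₁) ∪ A.filter fun p => p.rep ∈ W₂ := by
    intro x hx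
    rw [Finset.mem_inter] at hx
    simp only [Finset.mem_union, Finset.mem_filter]
    exact (hU x hx.1).imp (⟨hx.2, ·⟩) (⟨hx.2, ·⟩)
  have h7 := Finset.card_le_card h6
  have h8 := Finset.card_union_add_card_inter (A.filter fun p => p.rep ∈ W₁)
    (A.filter fun p => p.rep ∈ W₂)
  refine Or.inr ⟨Nat.odd_iff.2 (by omega), W₁, W₂, h₁, h₂, hne, ?_, by omega, by omega, ?_⟩
  · refine (finrank_inf_eq_zero_or_one h₁ h₂ hne).resolve_left fun h0 => ?_
    have h9 := h.card_diff_ge hU h0 hp'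
    have h10 := h.card_diff_ge (fun x hx => (hU x hx).symm) (by rwa [inf_comm]) hq'
    omega
  · intro x hx hxW
    have h9 : 0 < ((A.filter fun p => p.rep ∈ W₁) ∩ A.filter fun p => p.rep ∈ W₂).card :=
      Finset.card_pos.2 ⟨x, by simpa [hx] using hxW⟩
    omega

/-- The linear form on the dual space attached to a vector. -/
noncomputable def linPoly {σ : Type*} [Fintype σ] (v : σ → K) : MvPolynomial σ K :=
  ∑ i, MvPolynomial.C (v i) * MvPolynomial.X i

lemma mkDerivation_linPoly {σ : Type*} [Fintype σ] (φ : Dual K (σ → K)) (v : σ → K) :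
    MvPolynomial.mkDerivation K (fun i => (MvPolynomial.C (φ (Pi.single i 1)) : MvPolynomial σ K))
      (linPoly v) = MvPolynomial.C (φ v) := by
  have h : φ v = ∑ i, v i * φ (Pi.single i 1) := by
    conv_lhs => rw [← Finset.univ_sum_single v, map_sum]
    refine Finset.sum_congr rfl fun i _ => ?_
    rw [← smul_eq_mul, ← map_smul]
    congr 1
    ext j
    simp [Pi.single_apply]
  simp [linPoly, h, MvPolynomial.C_mul', MvPolynomial.mkDerivation_X]

/-- Apolarity: a relation between `n`-th powers of linear forms is a relation between the
evaluations of forms of degree `n` at the corresponding points. -/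
lemma sum_mul_eq_zero_of_sum_smul_linPoly_pow_eq_zero [CharZero K] {σ ι : Type*} [Fintype σ]
    (S : Finset ι) (v : ι → σ → K) {n : ℕ} (c : ι → K)
    (h : ∑ p ∈ S, c p • linPoly (v p) ^ n = 0) {F : (σ → K) → K} (hF : F ∈ linForms K (σ → K) ^ n) :
    ∑ p ∈ S, c p * F (v p) = 0 := by
  induction n generalizing c F with
  | zero =>
    rw [pow_zero] at hF
    obtain ⟨a, rfl⟩ := Submodule.mem_one.1 hF
    have h1 : ∑ p ∈ S, c p = 0 := by
      apply MvPolynomial.C_injective σ K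
      simpa [MvPolynomial.smul_eq_C_mul] using h
    simp [← Finset.sum_mul, h1]
  | succ n ih =>
    rw [pow_succ'] at hF
    induction hF using Submodule.mul_induction_on' with
    | mem_mul_mem g hg G hG =>
      obtain ⟨φ, rfl⟩ := hg
      have h1 := congrArg (MvPolynomial.mkDerivation K
        fun i => (MvPolynomial.C (φ (Pi.single i 1)) : MvPolynomial σ K)) h
      have h2 : ∑ p ∈ S, (c p * φ (v p)) • linPoly (v p) ^ n = 0 := by
        have h3 : ((n + 1 : ℕ) : MvPolynomial σ K) *
            ∑ p ∈ S, (c p * φ (v p)) • linPoly (v p) ^ n = 0 := by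
          rw [map_zero, map_sum] at h1
          rw [← h1, Finset.mul_sum]
          refine Finset.sum_congr rfl fun p _ => ?_
          rw [Derivation.map_smul, Derivation.leibniz_pow, mkDerivation_linPoly]
          simp only [MvPolynomial.smul_eq_C_mul, nsmul_eq_mul, smul_eq_mul, map_mul,
            Nat.add_sub_cancel]
          ring
        exact (mul_eq_zero.1 h3).resolve_left (Nat.cast_ne_zero.2 n.succ_ne_zero)
      have h4 := ih _ h2 hG
      simpa [mul_assoc] using h4
    | add x _ y _ hx hy => simp [mul_add, Finset.sum_add_distrib, hx, hy]

section Decompositions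

variable {K : Type} [Field K] {r d : ℕ} {f : MvPolynomial (Fin (r + 1)) K}

lemma mem_decompSpan_iff {A : Finset (ℙ K (Fin (r + 1) → K))} : f ∈ decompSpan K r d ↑A ↔
    ∃ a : ℙ K (Fin (r + 1) → K) → K, ∑ p ∈ A, a p • linPoly p.rep ^ d = f :=
  Submodule.mem_span_image_finset_iff_exists_fun' K

lemma exists_coeff_of_mem_decompSet {A : Finset (ℙ K (Fin (r + 1) → K))}
    (hA : A ∈ decompSet K r d f) :
    ∃ a : ℙ K (Fin (r + 1) → K) → K, (∀ p, p ∈ A ↔ a p ≠ 0) ∧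
      f = ∑ p ∈ A, a p • linPoly p.rep ^ d := by
  obtain ⟨a, ha⟩ := mem_decompSpan_iff.1 hA.1
  have hf : f = ∑ p ∈ A, (if p ∈ A then a p else 0) • linPoly p.rep ^ d := by
    rw [← ha]
    refine Finset.sum_congr rfl fun p hp => ?_
    rw [if_pos hp]
  refine ⟨fun p => if p ∈ A then a p else 0, fun p => ?_, hf⟩
  by_cases hp : p ∈ A
  · simp only [hp, if_true, true_iff]
    intro h0
    have h1 : f ∈ decompSpan K r d ↑(A.erase p) := by
      refine mem_decompSpan_iff.2 ⟨a, ?_⟩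
      rw [← ha, ← Finset.add_sum_erase A _ hp, h0, zero_smul, zero_add]
    have h2 : symRank K r d f ≤ (A.erase p).card := Nat.sInf_le ⟨_, rfl, h1⟩
    have h3 := Finset.card_erase_lt_of_mem hp
    have h4 := hA.2
    omega
  · simp [hp]

/-- Two distinct decompositions of the same polynomial yield a relation whose support `S` is
the same on both sides. -/
lemma exists_hasFullRelation_of_ne [CharZero K] {A B : Finset (ℙ K (Fin (r + 1) → K))}
    (hA : A ∈ decompSet K r d f) (hB : B ∈ decompSet K r d f) (hAB : A ≠ B) :
    ∃ S : Finset (ℙ K (Fin (r + 1) → K)), HasFullRelation d S ∧ S.Nonempty ∧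
      S.card ≤ 2 * (S ∩ A).card := by
  obtain ⟨a, ha, hfa⟩ := exists_coeff_of_mem_decompSet hA
  obtain ⟨b, hb, hfb⟩ := exists_coeff_of_mem_decompSet hB
  have hcard : A.card = B.card := hA.2.trans hB.2.symm
  set S := (A ∪ B).filter fun p => a p - b p ≠ 0 with hS
  have hrel : ∑ p ∈ S, (a p - b p) • linPoly p.rep ^ d = 0 := by
    have h1 : f = ∑ p ∈ A ∪ B, a p • linPoly p.rep ^ d := by
      rw [hfa]
      refine Finset.sum_subset Finset.subset_union_left fun p _ hp => ?_
      rw [not_not.1 (mt (ha p).2 hp), zero_smul]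
    have h2 : f = ∑ p ∈ A ∪ B, b p • linPoly p.rep ^ d := by
      rw [hfb]
      refine Finset.sum_subset Finset.subset_union_right fun p _ hp => ?_
      rw [not_not.1 (mt (hb p).2 hp), zero_smul]
    rw [hS, Finset.sum_filter_of_ne fun p _ hp => left_ne_zero_of_smul hp]
    simp only [sub_smul, Finset.sum_sub_distrib]
    rw [← h1, ← h2, sub_self]
  have hsub : ∀ p, p ∉ S → (p ∈ A ↔ p ∈ B) := by
    intro p hp
    rw [ha, hb]
    by_cases hpU : p ∈ A ∪ B
    · have h0 : a p - b p = 0 := by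
        by_contra h0
        exact hp (Finset.mem_filter.2 ⟨hpU, h0⟩)
      rw [sub_eq_zero.1 h0]
    · rw [← ha, ← hb]
      rw [Finset.mem_union, not_or] at hpU
      simp [hpU]
  have hdiff : A \ S = B \ S := by
    ext p
    simp only [Finset.mem_sdiff]
    exact and_congr_left (hsub p)
  refine ⟨S, ⟨fun p => a p - b p, fun p hp => (Finset.mem_filter.1 hp).2, fun F hF =>
    sum_mul_eq_zero_of_sum_smul_linPoly_pow_eq_zero S _ _ hrel hF⟩, ?_, ?_⟩
  · rw [Finset.nonempty_iff_ne_empty]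
    intro h0
    rw [h0, Finset.sdiff_empty, Finset.sdiff_empty] at hdiff
    exact hAB hdiff
  · have h1 := Finset.card_sdiff_add_card_inter A S
    have h2 := Finset.card_sdiff_add_card_inter B S
    have h3 : S ⊆ (A ∩ S) ∪ (B ∩ S) := by
      rw [← Finset.union_inter_distrib_right]
      exact Finset.subset_inter (Finset.filter_subset _ _) Finset.Subset.rfl
    have h4 := (Finset.card_le_card h3).trans (Finset.card_union_le _ _)
    rw [hdiff] at h1
    rw [Finset.inter_comm S A]
    omega

end Decompositions

lemma ncard_inter_eq_card_filter (A : Finset (ℙ K V)) (P : ℙ K V → Prop) :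
    ((↑A : Set (ℙ K V)) ∩ {p | P p}).ncard = (A.filter P).card := by
  rw [← Set.ncard_coe_finset, Finset.coe_filter]
  rfl

lemma isSmoothConic_setOf_onConic {K : Type} [Field K] {r : ℕ} {u v w : Fin (r + 1) → K}
    (h : LinearIndependent K ![u, v, w]) :
    ∃ T, IsSmoothConic K r T ∧
      ∀ p : ℙ K (Fin (r + 1) → K), OnConic (K := K) u v w p.rep → p ∈ T := by
  refine ⟨_, ⟨u, v, w, h, rfl⟩, fun p ⟨s, t, hst⟩ => ⟨s, t, ?_, ?_⟩⟩
  · by_contra! h0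
    exact p.rep_nonzero (by simp [hst, h0.1, h0.2])
  · rw [p.submodule_eq, hst]

end PointRelations

/-- trichotomy of Theorem 1.3: if `S(f)` contains two distinct
decompositions (`sr(f) = t`, `2t < 3d`, `r ≥ 2`, `d ≥ 3`), then every `A ∈ S(f)`
meets a line in `≥ ⌈(d+2)/2⌉` points, or a smooth conic in `≥ d + 1` points, or
(`d` odd) two distinct intersecting lines in `(d+1)/2` points each, the
intersection point not belonging to `A`. -/
theorem stmt_11 {K : Type} [Field K] [IsAlgClosed K] [CharZero K]
    {r d t : ℕ} (hr : 2 ≤ r) (hd : 3 ≤ d) (ht : 0 < t) (htd : 2 * t < 3 * d)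
    {f : MvPolynomial (Fin (r + 1)) K} (hf0 : f ≠ 0) (hfh : f.IsHomogeneous d)
    (hsr : symRank K r d f = t)
    {A₀ B₀ : Finset (Projectivization K (Fin (r + 1) → K))}
    (hA₀ : A₀ ∈ decompSet K r d f) (hB₀ : B₀ ∈ decompSet K r d f) (hAB₀ : A₀ ≠ B₀) :
    ∀ A ∈ decompSet K r d f,
      (∃ D : Set (Projectivization K (Fin (r + 1) → K)), IsProjLine K r D ∧
        (d + 3) / 2 ≤ ((↑A : Set (Projectivization K (Fin (r + 1) → K))) ∩ D).ncard)
      ∨ (∃ T : Set (Projectivization K (Fin (r + 1) → K)), IsSmoothConic K r T ∧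
        d + 1 ≤ ((↑A : Set (Projectivization K (Fin (r + 1) → K))) ∩ T).ncard)
      ∨ (Odd d ∧ ∃ W₁ W₂ : Submodule K (Fin (r + 1) → K),
          Module.finrank K W₁ = 2 ∧ Module.finrank K W₂ = 2 ∧ W₁ ≠ W₂ ∧
          Module.finrank K ↥(W₁ ⊓ W₂) = 1 ∧
          ((↑A : Set (Projectivization K (Fin (r + 1) → K)))
            ∩ {p | p.rep ∈ W₁}).ncard = (d + 1) / 2 ∧
          ((↑A : Set (Projectivization K (Fin (r + 1) → K)))
            ∩ {p | p.rep ∈ W₂}).ncard = (d + 1) / 2 ∧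
          ∀ p ∈ A, p.rep ∉ W₁ ⊓ W₂) := by
  classical
  intro A hA
  obtain ⟨B, hB, hAB⟩ : ∃ B ∈ decompSet K r d f, A ≠ B := by
    by_cases h : A = A₀
    · exact ⟨B₀, hB₀, h ▸ hAB₀⟩
    · exact ⟨A₀, hA₀, h⟩
  obtain ⟨S, hrel, hS, hcard⟩ := exists_hasFullRelation_of_ne hA hB hAB
  have hcA : A.card = t := hA.2.trans hsr
  have hle := Finset.card_le_card (Finset.inter_subset_right (s₁ := S) (s₂ := A))
  obtain ⟨e, rfl⟩ : ∃ e, d = e + 1 := ⟨d - 1, by omega⟩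
  rcases hrel.onTwoLines_or_onSmoothConic hS (by omega) with h | h
  · rcases hrel.trichotomy_of_onTwoLines hS hcard h with ⟨W, hW, hc⟩ |
      ⟨hodd, W₁, W₂, h₁, h₂, hne, hi, hc₁, hc₂, hA'⟩
    · refine Or.inl ⟨_, ⟨W, hW, rfl⟩, ?_⟩
      rwa [ncard_inter_eq_card_filter]
    · refine Or.inr (Or.inr ⟨hodd, W₁, W₂, h₁, h₂, hne, hi, ?_, ?_, hA'⟩)
      · rwa [ncard_inter_eq_card_filter]
      · rwa [ncard_inter_eq_card_filter]
  · obtain ⟨u, v, w, hL, hc⟩ := hrel.exists_conic_of_onSmoothConic hS hcard h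
    obtain ⟨T, hT, hsub⟩ := isSmoothConic_setOf_onConic hL
    refine Or.inr (Or.inl ⟨T, hT, hc.trans ?_⟩)
    rw [← ncard_inter_eq_card_filter]
    exact Set.ncard_le_ncard (Set.inter_subset_inter_right _ hsub)
      (A.finite_toSet.inter_of_left _)
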